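/- Let N ≥ 3, h = 2π/N, let D be the periodic central-difference Laplacian matrix, let ε > 0, and let G(u) = ε D u + (1/ε)(u − u.³). Let α_{ik}, β_{ik} (0 ≤ k < i ≤ s) satisfy α_{ik} ≥ 0, β_{ik} ≥ 0, β_{ik} = 0 whenever α_{ik} = 0, and Σ_{k=0}^{i−1} α_{ik} = 1 for each 1 ≤ i ≤ s. Set τ₀ = min{h²/(4ε), ε/4} and suppose 0 < τ satisfies τ β_{ik} ≤ α_{ik} τ₀ for all i,k. If ‖u_n‖_∞ ≤ 1, then the stages defined by v_0 = u_n and v_i = Σ_{k=0}^{i−1} (α_{ik} v_k + τ β_{ik} G(v_k)) satisfy ‖v_i‖_∞ ≤ 1 for all 1 ≤ i ≤ s; in particular u_{n+1} = v_s satisfies ‖u_{n+1}‖_∞ ≤ 1. -/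

import Mathlib

/-- The periodic central-difference Laplacian matrix on `Fin N` with mesh size `h`:
diagonal entries `-2/h²`, entries `1/h²` at positions `(j, j±1 mod N)`, `0` elsewhere. -/
noncomputable def periodicLap (N : ℕ) (h : ℝ) : Matrix (Fin N) (Fin N) ℝ :=
  Matrix.of fun i j =>
    if (j : ℕ) = (i : ℕ) then -2 / h ^ 2
    else if (j : ℕ) = ((i : ℕ) + 1) % N ∨ ((j : ℕ) + 1) % N = (i : ℕ) then 1 / h ^ 2
    else 0

/-- The semi-discrete Allen–Cahn right-hand side `G(u) = ε D u + (1/ε)(u - u.³)`. -/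
noncomputable def allenCahnG (N : ℕ) (h ε : ℝ) (u : Fin N → ℝ) : Fin N → ℝ :=
  ε • (periodicLap N h).mulVec u + ε⁻¹ • (fun j => u j - (u j) ^ 3)

theorem Nat.succ_mod_eq_ite {i N : ℕ} (hi : i < N) :
    (i + 1) % N = if i + 1 = N then 0 else i + 1 := by
  split_ifs with h
  · rw [h, Nat.mod_self]
  · exact Nat.mod_eq_of_lt (by omega)

theorem periodicLap_mulVec_apply {N : ℕ} (hN : 3 ≤ N) (h : ℝ) (i : Fin N) :
    ∃ p q : Fin N, ∀ u : Fin N → ℝ,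
      (periodicLap N h).mulVec u i = (u p + u q - 2 * u i) / h ^ 2 := by
  have hi := i.isLt
  obtain ⟨p, hp⟩ : ∃ p : Fin N, (p : ℕ) = if (i : ℕ) + 1 = N then 0 else (i : ℕ) + 1 :=
    ⟨⟨if (i : ℕ) + 1 = N then 0 else (i : ℕ) + 1, by split_ifs <;> omega⟩, rfl⟩
  obtain ⟨q, hq⟩ : ∃ q : Fin N, (q : ℕ) = if (i : ℕ) = 0 then N - 1 else (i : ℕ) - 1 :=
    ⟨⟨if (i : ℕ) = 0 then N - 1 else (i : ℕ) - 1, by split_ifs <;> omega⟩, rfl⟩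
  refine ⟨p, q, fun u => ?_⟩
  have entry : ∀ j : Fin N, periodicLap N h i j =
      (if j = i then -2 / h ^ 2 else 0) + (if j = p then 1 / h ^ 2 else 0)
        + (if j = q then 1 / h ^ 2 else 0) := by
    intro j
    have hj := j.isLt
    have next_i := Nat.succ_mod_eq_ite hi
    have next_j := Nat.succ_mod_eq_ite hj
    have hadj : ((j : ℕ) = ((i : ℕ) + 1) % N ∨ ((j : ℕ) + 1) % N = (i : ℕ)) ↔
        ((j : ℕ) = p ∨ (j : ℕ) = q) := by
      rw [next_i, next_j, hp, hq]
      split_ifs <;> omega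
    have hpi : (p : ℕ) ≠ i := by rw [hp]; split_ifs <;> omega
    have hqi : (q : ℕ) ≠ i := by rw [hq]; split_ifs <;> omega
    have hpq : (p : ℕ) ≠ q := by rw [hp, hq]; split_ifs <;> omega
    simp only [periodicLap, Matrix.of_apply, hadj, Fin.ext_iff]
    split_ifs <;> first | omega | simp
  simp only [Matrix.mulVec, dotProduct, entry, add_mul, ite_mul, zero_mul,
    Finset.sum_add_distrib, Finset.sum_ite_eq', Finset.mem_univ, if_true]
  ring

theorem abs_diffusion_step_le {a c x y z : ℝ} (hc : 0 ≤ c) (hca : 4 * c ≤ a)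
    (hx : |x| ≤ 1) (hy : |y| ≤ 1) (hz : |z| ≤ 1) :
    |a / 2 * x + c * (y + z - 2 * x)| ≤ a / 2 := by
  rw [abs_le] at *
  constructor <;> nlinarith

theorem abs_reaction_step_le {a c x : ℝ} (hc : 0 ≤ c) (hca : 4 * c ≤ a) (hx : |x| ≤ 1) :
    |a / 2 * x + c * (x - x ^ 3)| ≤ a / 2 := by
  rw [abs_le] at *
  obtain ⟨hx₀, hx₁⟩ := hx
  have upper_sq : c * (x + x ^ 2) ≤ c * 2 := mul_le_mul_of_nonneg_left (by nlinarith) hc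
  have lower_sq : c * (x ^ 2 - x) ≤ c * 2 := mul_le_mul_of_nonneg_left (by nlinarith) hc
  have upper : 0 ≤ (1 - x) * (a / 2 - c * (x + x ^ 2)) :=
    mul_nonneg (by linarith) (by linarith)
  have lower : 0 ≤ (1 + x) * (a / 2 - c * (x ^ 2 - x)) :=
    mul_nonneg (by linarith) (by linarith)
  constructor <;> linarith

/-- A weighted forward Euler step for the semi-discrete Allen–Cahn equation maps the unit ball
of the sup norm into the ball whose radius is the weight. -/
theorem norm_smul_add_smul_allenCahnG_le {N : ℕ} (hN : 3 ≤ N) {h ε a b : ℝ} (hh : 0 < h)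
    (hε : 0 < ε) (ha : 0 ≤ a) (hb : 0 ≤ b) (hab : b ≤ a * min (h ^ 2 / (4 * ε)) (ε / 4))
    {u : Fin N → ℝ} (hu : ‖u‖ ≤ 1) :
    ‖a • u + b • allenCahnG N h ε u‖ ≤ a := by
  have hu' : ∀ j, |u j| ≤ 1 := fun j => (norm_le_pi_norm u j).trans hu
  have hdiff : 4 * (b * ε / h ^ 2) ≤ a := by
    have := hab.trans (mul_le_mul_of_nonneg_left (min_le_left _ _) ha)
    rw [← mul_div_assoc, le_div_iff₀ (by positivity)] at this
    rw [← mul_div_assoc, div_le_iff₀ (by positivity)]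
    linarith
  have hreac : 4 * (b / ε) ≤ a := by
    have := hab.trans (mul_le_mul_of_nonneg_left (min_le_right _ _) ha)
    rw [← mul_div_assoc, div_le_iff₀ hε]
    linarith
  refine (pi_norm_le_iff_of_nonneg ha).2 fun i => ?_
  obtain ⟨p, q, hpq⟩ := periodicLap_mulVec_apply hN h i
  have split : (a • u + b • allenCahnG N h ε u) i =
      (a / 2 * u i + b * ε / h ^ 2 * (u p + u q - 2 * u i)) +
        (a / 2 * u i + b / ε * (u i - u i ^ 3)) := by
    simp only [allenCahnG, Pi.add_apply, Pi.smul_apply, smul_eq_mul, hpq]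
    ring
  rw [Real.norm_eq_abs, split]
  refine (abs_add_le _ _).trans ?_
  have := abs_diffusion_step_le (by positivity) hdiff (hu' i) (hu' p) (hu' q)
  have := abs_reaction_step_le (by positivity) hreac (hu' i)
  linarith

/-- Under the RK-SSP condition on `(α, β)` and the time-step
restriction `τ β i k ≤ α i k * τ₀` with `τ₀ = min{h²/(4ε), ε/4}`, the Shu–Osher
stages for the semi-discrete Allen–Cahn equation preserve the maximum bound:
if `‖uₙ‖_∞ ≤ 1` then `‖v i‖_∞ ≤ 1` for all `i ≤ s`; in particular
`u_{n+1} = v s` satisfies `‖u_{n+1}‖_∞ ≤ 1`.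
(The sup norm is the default norm on `Fin N → ℝ`.) -/
theorem shu_osher_MBP_allenCahn
    (N : ℕ) (hN : 3 ≤ N) (ε : ℝ) (hε : 0 < ε)
    (s : ℕ) (α β : ℕ → ℕ → ℝ)
    (hα : ∀ i k, k < i → i ≤ s → 0 ≤ α i k)
    (hβ : ∀ i k, k < i → i ≤ s → 0 ≤ β i k)
    (hzero : ∀ i k, k < i → i ≤ s → α i k = 0 → β i k = 0)
    (hsum : ∀ i, 1 ≤ i → i ≤ s → ∑ k ∈ Finset.range i, α i k = 1)
    (τ : ℝ) (hτ : 0 < τ)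
    (hstep : ∀ i k, k < i → i ≤ s →
      τ * β i k ≤ α i k * min ((2 * Real.pi / N) ^ 2 / (4 * ε)) (ε / 4))
    (un : Fin N → ℝ) (hun : ‖un‖ ≤ 1)
    (v : ℕ → Fin N → ℝ) (hv0 : v 0 = un)
    (hv : ∀ i, 1 ≤ i → i ≤ s →
      v i = ∑ k ∈ Finset.range i,
        (α i k • v k + (τ * β i k) • allenCahnG N (2 * Real.pi / N) ε (v k))) :
    ∀ i, i ≤ s → ‖v i‖ ≤ 1 := by
  intro i
  induction i using Nat.strong_induction_on with
  | _ i ih =>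
    intro his
    rcases Nat.eq_zero_or_pos i with rfl | hi
    · rwa [hv0]
    · rw [hv i hi his, ← hsum i hi his]
      refine norm_sum_le_of_le _ fun k hk => ?_
      have hki := Finset.mem_range.1 hk
      have hN₀ : (0 : ℝ) < N := by exact_mod_cast (by omega : 0 < N)
      exact norm_smul_add_smul_allenCahnG_le hN (by positivity) hε (hα i k hki his)
        (mul_nonneg hτ.le (hβ i k hki his)) (hstep i k hki his) (ih k hki (by omega))
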